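/- Let p be an odd prime, q = p^m with q = 2^a·b − 1, b odd, a = 2, let r ≥ 3, and N = 2^r·p^s. Let C be the ideal of R = F_q[x]/(x^N − 1) generated by m_0(x)^{j_0} · m_{2^{r−1}}(x)^{j_{2^{r−1}}} · m_{2^{r−2}}(x)^{j_{2^{r−2}}} · ∏_{i=3}^r ∏_{s ∈ O_i} m_{2^{r−i}s}(x)^{j_{2^{r−i}s}}, where 0 ≤ j_t ≤ p^s for each t ∈ T_n. Then C^⊥ ⊆ C if and only if 2·j_0 < p^s, 2·j_{2^{r−1}} < p^s, 2·j_{2^{r−2}} < p^s, and j_{2^{r−i}s} + j_{2^{r−i}(−s)} ≤ p^s for every s ∈ O_i and every 3 ≤ i ≤ r. Moreover, the number of ideals C of R with C^⊥ ⊆ C equals (p^s+2)^{r−2} · ((p^s+1)/2)^{r+1}. -/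

import Mathlib

open Polynomial

/-- The coefficient vector (with respect to the basis `1, x, …, x^{deg f − 1}` of
`F[x]/(f)`) of an element of `F[x]/(f)`. -/
noncomputable def coeffRepr {F : Type*} [Field F] {f : Polynomial F} (hf : f ≠ 0)
    (x : AdjoinRoot f) (i : Fin (AdjoinRoot.powerBasis hf).dim) : F :=
  (AdjoinRoot.powerBasis hf).basis.repr x i

/-- The (Euclidean) dual code of a cyclic code `C ⊆ F[x]/(f)`. -/
noncomputable def dualCode {F : Type*} [Field F] {f : Polynomial F} (hf : f ≠ 0)
    (C : Ideal (AdjoinRoot f)) : Set (AdjoinRoot f) :=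
  {x | ∀ y ∈ C, ∑ i, coeffRepr hf x i * coeffRepr hf y i = 0}

/-! ### The reciprocal automorphism and duality -/

section Reciprocal

variable {F : Type*} [Field F] {N : ℕ}

lemma root_pow_card (N : ℕ) : AdjoinRoot.root (X ^ N - 1 : F[X]) ^ N = 1 := by
  have h := AdjoinRoot.eval₂_root (X ^ N - 1 : F[X])
  simpa [sub_eq_zero] using h

lemma root_pow_mod (k : ℕ) :
    AdjoinRoot.root (X ^ N - 1 : F[X]) ^ k = AdjoinRoot.root (X ^ N - 1 : F[X]) ^ (k % N) := by
  conv_lhs => rw [← Nat.div_add_mod k N, pow_add, pow_mul, root_pow_card, one_pow, one_mul]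

/-- The `F`-algebra endomorphism of `F[x]/(x^N - 1)` sending `x` to `x^(N-1) = x⁻¹`. -/
noncomputable def reciprocalHom (F : Type*) [Field F] (N : ℕ) :
    AdjoinRoot (X ^ N - 1 : F[X]) →ₐ[F] AdjoinRoot (X ^ N - 1 : F[X]) :=
  AdjoinRoot.liftAlgHom _ (Algebra.ofId F _) (AdjoinRoot.root (X ^ N - 1 : F[X]) ^ (N - 1)) (by
    simp [← pow_mul', pow_mul, root_pow_card])

@[simp]
lemma reciprocalHom_root :
    reciprocalHom F N (AdjoinRoot.root (X ^ N - 1 : F[X])) =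
      AdjoinRoot.root (X ^ N - 1 : F[X]) ^ (N - 1) :=
  AdjoinRoot.liftAlgHom_root ..

lemma reciprocalHom_reciprocalHom (hN : 0 < N) (x : AdjoinRoot (X ^ N - 1 : F[X])) :
    reciprocalHom F N (reciprocalHom F N x) = x := by
  have h : (reciprocalHom F N).comp (reciprocalHom F N) = AlgHom.id F _ := by
    apply AdjoinRoot.algHom_ext
    simp only [AlgHom.comp_apply, reciprocalHom_root, map_pow, AlgHom.id_apply, ← pow_mul]
    rcases Nat.lt_or_ge 1 N with h1 | h1
    · obtain ⟨n, hn⟩ : ∃ n, (N - 1) * (N - 1) = N * n + 1 := by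
        refine ⟨N - 2, ?_⟩
        zify [hN, h1, show 2 ≤ N from h1, show 1 ≤ N from hN]
        ring
      rw [hn, pow_add, pow_mul, root_pow_card]
      simp
    · obtain rfl : N = 1 := by omega
      simpa using (root_pow_card (F := F) 1).symm
  exact DFunLike.congr_fun h x

lemma reciprocalHom_mk (g : F[X]) :
    reciprocalHom F N (AdjoinRoot.mk _ g) = AdjoinRoot.mk _ (g.comp (X ^ (N - 1))) := by
  rw [← AdjoinRoot.aeval_eq, ← AdjoinRoot.aeval_eq, aeval_comp, ← Polynomial.aeval_algHom_apply]
  simp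

variable (hf : (X ^ N - 1 : F[X]) ≠ 0)

lemma dim_eq : (AdjoinRoot.powerBasis hf).dim = N := by
  rw [AdjoinRoot.powerBasis_dim, ← C_1, natDegree_X_pow_sub_C]

lemma val_lt (i : Fin (AdjoinRoot.powerBasis hf).dim) : (i : ℕ) < N :=
  i.2.trans_eq (dim_eq hf)

lemma powerBasis_eq (i : Fin (AdjoinRoot.powerBasis hf).dim) :
    (AdjoinRoot.powerBasis hf).basis i = AdjoinRoot.root (X ^ N - 1 : F[X]) ^ (i : ℕ) := by
  simp

lemma coeffRepr_root_pow (k : ℕ) (i : Fin (AdjoinRoot.powerBasis hf).dim) :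
    coeffRepr hf (AdjoinRoot.root (X ^ N - 1 : F[X]) ^ k) i = if k % N = i then 1 else 0 := by
  have hN : 0 < N := (Nat.zero_le _).trans_lt (val_lt hf i)
  have hk : k % N < (AdjoinRoot.powerBasis hf).dim := by rw [dim_eq]; exact Nat.mod_lt _ hN
  have h := powerBasis_eq hf ⟨k % N, hk⟩
  rw [root_pow_mod, coeffRepr]
  simp only at h
  rw [← h, Module.Basis.repr_self, Finsupp.single_apply]
  simp [Fin.ext_iff]

lemma coeffRepr_eq_sum (x : AdjoinRoot (X ^ N - 1 : F[X])) :
    ∑ i, coeffRepr hf x i • AdjoinRoot.root (X ^ N - 1 : F[X]) ^ (i : ℕ) = x := by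
  simp only [← powerBasis_eq]
  exact (AdjoinRoot.powerBasis hf).basis.sum_repr x

lemma sum_coeffRepr_mul (hN : 0 < N) (x y : AdjoinRoot (X ^ N - 1 : F[X])) :
    ∑ i, coeffRepr hf x i * coeffRepr hf y i =
      coeffRepr hf (x * reciprocalHom F N y) ⟨0, by rwa [dim_eq]⟩ := by
  set o : Fin (AdjoinRoot.powerBasis hf).dim := ⟨0, by rwa [dim_eq]⟩ with ho
  have key (i k : Fin (AdjoinRoot.powerBasis hf).dim) :
      coeffRepr hf (AdjoinRoot.root (X ^ N - 1 : F[X]) ^ (i : ℕ) *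
        AdjoinRoot.root (X ^ N - 1 : F[X]) ^ ((N - 1) * (k : ℕ))) o = if i = k then 1 else 0 := by
    rw [← pow_add, coeffRepr_root_pow]
    have hi := val_lt hf i
    have hk := val_lt hf k
    congr 1
    rw [eq_iff_iff, ho, Fin.ext_iff]
    dsimp only
    rw [← Nat.dvd_iff_mod_eq_zero, ← Int.natCast_dvd_natCast]
    push_cast [Nat.cast_sub (show 1 ≤ N from hN)]
    rw [show (i : ℤ) + (N - 1) * (k : ℤ) = N * k + (i - k) by ring, dvd_add_right (dvd_mul_right _ _)]
    constructor
    · intro h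
      have := Int.eq_zero_of_abs_lt_dvd h (by rw [abs_lt]; omega)
      omega
    · intro h; simp [h]
  conv_rhs => rw [← coeffRepr_eq_sum hf x, ← coeffRepr_eq_sum hf y]
  simp only [map_sum, map_smul, map_pow, reciprocalHom_root, ← pow_mul, Finset.sum_mul_sum,
    smul_mul_smul_comm]
  simp only [coeffRepr, map_sum, map_smul, Finsupp.coe_finsetSum, Finset.sum_apply,
    Finsupp.smul_apply]
  simp only [coeffRepr] at key
  simp [key]

lemma dualCode_eq_annihilator (hN : 0 < N) (D : Ideal (AdjoinRoot (X ^ N - 1 : F[X]))) :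
    dualCode hf D = {x | ∀ y ∈ D, x * reciprocalHom F N y = 0} := by
  ext x
  simp only [dualCode, Set.mem_ofPred_eq, sum_coeffRepr_mul hf hN]
  constructor
  · intro h y hy
    rw [← coeffRepr_eq_sum hf (x * reciprocalHom F N y)]
    refine Finset.sum_eq_zero fun i _ => ?_
    have := h (y * AdjoinRoot.root _ ^ (i : ℕ)) (D.mul_mem_right _ hy)
    rw [map_mul, ← mul_assoc, ← sum_coeffRepr_mul hf hN] at this
    simp only [coeffRepr_root_pow, Nat.mod_eq_of_lt (val_lt hf i), ← Fin.ext_iff] at this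
    simp at this
    simp [this]
  · intro h y hy
    rw [h y hy]
    simp [coeffRepr]

end Reciprocal

/-! ### Ideals of `F[x]/(f)` in terms of the factorization of `f` -/

section Ideals

variable {F : Type*} [Field F] {ι : Type*} [Fintype ι] {P : ι → F[X]}

lemma prod_pow_dvd_prod_pow_iff (hP : ∀ k, Irreducible (P k))
    (hcop : Pairwise fun k l => IsCoprime (P k) (P l)) {J J' : ι → ℕ} :
    ∏ k, P k ^ J k ∣ ∏ k, P k ^ J' k ↔ J ≤ J' := by
  classical
  refine ⟨fun h k => ?_, fun h => Finset.prod_dvd_prod_of_dvd _ _ fun k _ => pow_dvd_pow _ (h k)⟩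
  have h1 : P k ^ J k ∣ P k ^ J' k * ∏ l ∈ Finset.univ.erase k, P l ^ J' l := by
    rw [Finset.mul_prod_erase Finset.univ (fun l => P l ^ J' l) (Finset.mem_univ k)]
    exact (Finset.dvd_prod_of_mem (fun l => P l ^ J l) (Finset.mem_univ k)).trans h
  have h2 : IsCoprime (P k ^ J k) (∏ l ∈ Finset.univ.erase k, P l ^ J' l) :=
    IsCoprime.prod_right fun l hl => (hcop (Finset.ne_of_mem_erase hl).symm).pow
  exact (pow_dvd_pow_iff (hP k).ne_zero (hP k).not_isUnit).1 (h2.dvd_of_dvd_mul_right h1)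

lemma exists_associated_prod_pow (hP : ∀ k, Irreducible (P k)) {e : ℕ} {g : F[X]}
    (hg : g ∣ ∏ k, P k ^ e) : ∃ J : ι → ℕ, (∀ k, J k ≤ e) ∧ Associated g (∏ k, P k ^ J k) := by
  classical
  suffices H : ∀ (s : Finset ι) (g : F[X]), g ∣ ∏ k ∈ s, P k ^ e →
      ∃ J : ι → ℕ, (∀ k, J k ≤ e) ∧ Associated g (∏ k ∈ s, P k ^ J k) from H _ g hg
  intro s
  induction s using Finset.induction_on with
  | empty =>
    intro g hg
    exact ⟨fun _ => 0, by simp, by simpa [associated_one_iff_isUnit, isUnit_iff_dvd_one] using hg⟩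
  | insert k s hk ih =>
    intro g hg
    rw [Finset.prod_insert hk] at hg
    obtain ⟨u, v, hu, hv, rfl⟩ := exists_dvd_and_dvd_of_dvd_mul hg
    obtain ⟨n, hn, hun⟩ := (dvd_prime_pow (hP k).prime e).1 hu
    obtain ⟨J, hJ, hvJ⟩ := ih v hv
    refine ⟨Function.update J k n, fun l => ?_, ?_⟩
    · rcases eq_or_ne l k with rfl | hl
      · simpa using hn
      · simpa [hl] using hJ l
    · rw [Finset.prod_insert hk, Function.update_self]
      refine hun.mul_mul (hvJ.trans (Associated.of_eq (Finset.prod_congr rfl fun l hl => ?_)))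
      rw [Function.update_of_ne (ne_of_mem_of_not_mem hl hk)]

lemma mk_dvd_mk_iff {f g h : F[X]} (hg : g ∣ f) :
    AdjoinRoot.mk f g ∣ AdjoinRoot.mk f h ↔ g ∣ h := by
  refine ⟨fun ⟨x, hx⟩ => ?_, map_dvd _⟩
  obtain ⟨x, rfl⟩ := AdjoinRoot.mk_surjective x
  rw [← map_mul, AdjoinRoot.mk_eq_mk] at hx
  exact (dvd_sub_left (dvd_mul_right g x)).1 (hg.trans hx)

lemma exists_eq_span_mk {f : F[X]} (D : Ideal (AdjoinRoot f)) :
    ∃ g : F[X], g ∣ f ∧ D = Ideal.span {AdjoinRoot.mk f g} := by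
  obtain ⟨g, hg⟩ := (IsPrincipalIdealRing.principal (D.comap (AdjoinRoot.mk f))).principal
  rw [← Ideal.span] at hg
  refine ⟨g, ?_, ?_⟩
  · rw [← Ideal.mem_span_singleton, ← hg, Ideal.mem_comap, AdjoinRoot.mk_self]
    exact D.zero_mem
  · rw [← Ideal.map_comap_of_surjective _ AdjoinRoot.mk_surjective D, hg, Ideal.map_span,
      Set.image_singleton]

end Ideals

section Dual

variable {F : Type*} [Field F] {N e : ℕ} {ι : Type*} [Fintype ι] {P : ι → F[X]} {σ : ι → ι}

/-- The cyclic code of length `N` generated by `∏ P_k ^ J_k`. -/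
noncomputable def codeOfExponents (N : ℕ) (P : ι → F[X]) (J : ι → ℕ) :
    Ideal (AdjoinRoot (X ^ N - 1 : F[X])) :=
  Ideal.span {AdjoinRoot.mk _ (∏ k, P k ^ J k)}

lemma codeOfExponents_le_iff (hP : ∀ k, Irreducible (P k))
    (hcop : Pairwise fun k l => IsCoprime (P k) (P l)) (hfac : X ^ N - 1 = ∏ k, P k ^ e)
    {J J' : ι → ℕ} (hJ' : ∀ k, J' k ≤ e) :
    codeOfExponents N P J ≤ codeOfExponents N P J' ↔ J' ≤ J := by
  rw [codeOfExponents, codeOfExponents, Ideal.span_singleton_le_span_singleton, mk_dvd_mk_iff,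
    prod_pow_dvd_prod_pow_iff hP hcop]
  rw [hfac]
  exact (prod_pow_dvd_prod_pow_iff hP hcop (J' := fun _ => e)).2 hJ'

lemma exists_eq_codeOfExponents (hP : ∀ k, Irreducible (P k)) (hfac : X ^ N - 1 = ∏ k, P k ^ e)
    (D : Ideal (AdjoinRoot (X ^ N - 1 : F[X]))) :
    ∃ J : ι → ℕ, (∀ k, J k ≤ e) ∧ D = codeOfExponents N P J := by
  obtain ⟨g, hg, rfl⟩ := exists_eq_span_mk D
  obtain ⟨J, hJ, hgJ⟩ := exists_associated_prod_pow hP (hfac ▸ hg)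
  refine ⟨J, hJ, le_antisymm ?_ ?_⟩ <;> rw [codeOfExponents, Ideal.span_singleton_le_span_singleton]
  · exact map_dvd _ hgJ.symm.dvd
  · exact map_dvd _ hgJ.dvd

lemma dualCode_codeOfExponents (hf : (X ^ N - 1 : F[X]) ≠ 0) (hN : 0 < N)
    (hfac : X ^ N - 1 = ∏ k, P k ^ e) (hσ : Function.Involutive σ)
    (hrec : ∀ k, P (σ k) ∣ (P k).comp (X ^ (N - 1))) {J : ι → ℕ} (hJ : ∀ k, J k ≤ e) :
    dualCode hf (codeOfExponents N P J) = codeOfExponents N P fun k => e - J (σ k) := by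
  have h1 (k : ι) : AdjoinRoot.mk (X ^ N - 1) (P (σ k)) ∣
      reciprocalHom F N (AdjoinRoot.mk _ (P k)) := by
    rw [reciprocalHom_mk]
    exact map_dvd _ (hrec k)
  have h2 (k : ι) : reciprocalHom F N (AdjoinRoot.mk _ (P k)) ∣
      AdjoinRoot.mk (X ^ N - 1) (P (σ k)) := by
    have := map_dvd (reciprocalHom F N) (h1 (σ k))
    rwa [hσ, reciprocalHom_reciprocalHom hN] at this
  have h3 : AdjoinRoot.mk (X ^ N - 1) (∏ k, P (σ k) ^ J k) ∣
      reciprocalHom F N (AdjoinRoot.mk _ (∏ k, P k ^ J k)) := by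
    simp only [map_prod, map_pow]
    exact Finset.prod_dvd_prod_of_dvd _ _ fun k _ => pow_dvd_pow_of_dvd (h1 k) _
  have h4 : reciprocalHom F N (AdjoinRoot.mk _ (∏ k, P k ^ J k)) ∣
      AdjoinRoot.mk (X ^ N - 1) (∏ k, P (σ k) ^ J k) := by
    simp only [map_prod, map_pow]
    exact Finset.prod_dvd_prod_of_dvd _ _ fun k _ => pow_dvd_pow_of_dvd (h2 k) _
  have h5 : (∏ k, P (σ k) ^ J k) = ∏ k, P k ^ J (σ k) := by
    rw [← Equiv.prod_comp hσ.toPerm (fun k => P k ^ J (σ k))]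
    simp [hσ _]
  have h6 : (X ^ N - 1 : F[X]) = (∏ k, P k ^ (e - J (σ k))) * ∏ k, P k ^ J (σ k) := by
    rw [hfac, ← Finset.prod_mul_distrib]
    exact Finset.prod_congr rfl fun k _ => by rw [← pow_add, Nat.sub_add_cancel (hJ _)]
  rw [dualCode_eq_annihilator hf hN]
  ext x
  obtain ⟨g, rfl⟩ := AdjoinRoot.mk_surjective x
  have h7 : (∀ y ∈ codeOfExponents N P J, AdjoinRoot.mk _ g * reciprocalHom F N y = 0) ↔
      AdjoinRoot.mk (X ^ N - 1) (g * ∏ k, P k ^ J (σ k)) = 0 := by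
    rw [map_mul, ← h5]
    constructor
    · intro h
      obtain ⟨z, hz⟩ := h4
      rw [hz, ← mul_assoc, h _ (Ideal.mem_span_singleton_self _), zero_mul]
    · intro h y hy
      obtain ⟨z, hz⟩ := h3.trans (map_dvd _ (Ideal.mem_span_singleton.1 hy))
      rw [hz, ← mul_assoc, h, zero_mul]
  have hne : (∏ k, P k ^ J (σ k)) ≠ 0 := fun h0 => hf (by rw [h6, h0, mul_zero])
  rw [Set.mem_ofPred_eq, h7, AdjoinRoot.mk_eq_zero, SetLike.mem_coe, codeOfExponents,
    Ideal.mem_span_singleton, mk_dvd_mk_iff (by rw [h6]; exact dvd_mul_right _ _)]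
  conv_lhs => rw [h6]
  exact mul_dvd_mul_iff_right hne

lemma dualCode_codeOfExponents_subset_iff (hf : (X ^ N - 1 : F[X]) ≠ 0) (hN : 0 < N)
    (hP : ∀ k, Irreducible (P k)) (hcop : Pairwise fun k l => IsCoprime (P k) (P l))
    (hfac : X ^ N - 1 = ∏ k, P k ^ e) (hσ : Function.Involutive σ)
    (hrec : ∀ k, P (σ k) ∣ (P k).comp (X ^ (N - 1))) {J : ι → ℕ} (hJ : ∀ k, J k ≤ e) :
    dualCode hf (codeOfExponents N P J) ⊆ codeOfExponents N P J ↔ ∀ k, J k + J (σ k) ≤ e := by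
  rw [dualCode_codeOfExponents hf hN hfac hσ hrec hJ, SetLike.coe_subset_coe,
    codeOfExponents_le_iff hP hcop hfac hJ, Pi.le_def]
  exact forall_congr' fun k => by have := hJ (σ k); omega

lemma ncard_dualCode_subset (hf : (X ^ N - 1 : F[X]) ≠ 0) (hN : 0 < N)
    (hP : ∀ k, Irreducible (P k)) (hcop : Pairwise fun k l => IsCoprime (P k) (P l))
    (hfac : X ^ N - 1 = ∏ k, P k ^ e) (hσ : Function.Involutive σ)
    (hrec : ∀ k, P (σ k) ∣ (P k).comp (X ^ (N - 1))) :
    {D : Ideal (AdjoinRoot (X ^ N - 1 : F[X])) | dualCode hf D ⊆ ↑D}.ncard =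
      {J : ι → ℕ | ∀ k, J k + J (σ k) ≤ e}.ncard := by
  have hle {J : ι → ℕ} (h : ∀ k, J k + J (σ k) ≤ e) (k : ι) : J k ≤ e :=
    (Nat.le_add_right _ _).trans (h k)
  have himage : {D : Ideal (AdjoinRoot (X ^ N - 1 : F[X])) | dualCode hf D ⊆ ↑D} =
      codeOfExponents N P '' {J : ι → ℕ | ∀ k, J k + J (σ k) ≤ e} := by
    ext D
    constructor
    · intro hD
      obtain ⟨J, hJ, rfl⟩ := exists_eq_codeOfExponents hP hfac D
      exact ⟨J, (dualCode_codeOfExponents_subset_iff hf hN hP hcop hfac hσ hrec hJ).1 hD, rfl⟩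
    · rintro ⟨J, hJ, rfl⟩
      exact (dualCode_codeOfExponents_subset_iff hf hN hP hcop hfac hσ hrec (hle hJ)).2 hJ
  rw [himage]
  refine Set.InjOn.ncard_image fun J hJ J' hJ' h => le_antisymm ?_ ?_
  · exact (codeOfExponents_le_iff hP hcop hfac (hle hJ)).1 h.ge
  · exact (codeOfExponents_le_iff hP hcop hfac (hle hJ')).1 h.le

end Dual

/-! ### Counting exponents -/

section Count

lemma card_pairs_add_le (e : ℕ) :
    {x : ℕ × ℕ | x.1 + x.2 ≤ e}.ncard = (e + 1) * (e + 2) / 2 := by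
  have h : {x : ℕ × ℕ | x.1 + x.2 ≤ e} =
      ↑((Finset.range (e + 1)).biUnion fun n => Finset.HasAntidiagonal.antidiagonal n) := by
    ext x
    simp
  rw [h, Set.ncard_coe_finset, Finset.card_biUnion]
  · simp only [Finset.Nat.card_antidiagonal]
    have := Finset.sum_range_succ' (fun i => i) (e + 1)
    simp only [add_zero] at this
    rw [← this, Finset.sum_range_id, mul_comm]
    rfl
  · intro a _ b _ hab
    rw [Function.onFun, Finset.disjoint_left]
    intro x hx hx'
    rw [Finset.HasAntidiagonal.mem_antidiagonal] at hx hx'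
    exact hab (hx.symm.trans hx')

/-- The involution swapping the two members of every pair and fixing all the other indices. -/
def pairSwap (κ I : Type*) : κ ⊕ I × Bool → κ ⊕ I × Bool :=
  Sum.map id (Prod.map id not)

lemma pairSwap_involutive (κ I : Type*) : Function.Involutive (pairSwap κ I) := by
  rintro (k | ⟨i, b⟩) <;> simp [pairSwap]

lemma ncard_add_pairSwap_le (κ I : Type*) [Finite κ] [Finite I] (e : ℕ) (he : Odd e) :
    {J : κ ⊕ I × Bool → ℕ | ∀ k, J k + J (pairSwap κ I k) ≤ e}.ncard =
      ((e + 1) / 2) ^ Nat.card κ * ((e + 1) * (e + 2) / 2) ^ Nat.card I := by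
  obtain ⟨d, rfl⟩ := he
  have hd : (2 * d + 1 + 1) / 2 = d + 1 := by omega
  rw [← card_pairs_add_le, hd, ← Nat.card_coe_set_eq, ← Nat.card_coe_set_eq]
  have hfin : Nat.card (Fin (d + 1)) = d + 1 := Nat.card_fin _
  conv_rhs => rw [← hfin, ← Nat.card_fun, ← Nat.card_fun, ← Nat.card_prod]
  refine Nat.card_congr
    { toFun := fun J => ⟨fun k => ⟨J.1 (.inl k), ?_⟩,
        fun i => ⟨(J.1 (.inr (i, true)), J.1 (.inr (i, false))), ?_⟩⟩
      invFun := fun x => ⟨Sum.elim (fun k => (x.1 k : ℕ))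
        fun y => bif y.2 then (x.2 y.1).1.1 else (x.2 y.1).1.2, ?_⟩
      left_inv := ?_
      right_inv := ?_ }
  · have := J.2 (.inl k)
    simp only [pairSwap, Sum.map_inl, id] at this
    omega
  · exact J.2 (.inr (i, true))
  · rintro (k | ⟨i, b⟩)
    · have := (x.1 k).2
      simp only [pairSwap, Sum.map_inl, id, Sum.elim_inl]
      omega
    · have := (x.2 i).2
      simp only [Set.mem_ofPred_eq] at this
      cases b <;> simp [pairSwap] <;> omega
  · intro J
    ext (k | ⟨i, b⟩)
    · rfl
    · cases b <;> rfl
  · intro x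
    rfl

end Count

/-! ### Odd residues modulo powers of two -/

section Residues

lemma pow_two_pow_modEq {q : ℤ} (hq : q % 8 = 3) (i : ℕ) :
    q ^ 2 ^ (i + 1) ≡ 1 + 2 ^ (i + 3) [ZMOD 2 ^ (i + 4)] := by
  induction i with
  | zero =>
    obtain ⟨z, rfl⟩ : ∃ z, q = 8 * z + 3 := ⟨q / 8, by omega⟩
    refine (Int.modEq_iff_dvd.2 ⟨-4 * z ^ 2 - 3 * z, ?_⟩)
    ring
  | succ i ih =>
    obtain ⟨z, hz⟩ := Int.modEq_iff_dvd.1 ih.symm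
    have hz' : q ^ 2 ^ (i + 1) = 1 + 2 ^ (i + 3) + 2 ^ (i + 4) * z := by linarith
    rw [pow_succ 2 (i + 1), pow_mul, hz']
    refine (Int.modEq_iff_dvd.2
      ⟨-(2 ^ (i + 1) + z + 2 ^ (i + 3) * z + 2 ^ (i + 3) * z ^ 2), ?_⟩)
    ring

/-- If `q ≡ 3 (mod 8)`, then `q` and `-1` generate the odd residues modulo `2 ^ i`. -/
lemma exists_modEq_pow_or_neg_pow {q : ℤ} (hq : q % 8 = 3) {i : ℕ} (hi : 3 ≤ i) {u : ℤ}
    (hu : Odd u) : ∃ k : ℕ, u ≡ q ^ k [ZMOD 2 ^ i] ∨ u ≡ -q ^ k [ZMOD 2 ^ i] := by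
  induction i, hi using Nat.le_induction with
  | base =>
    have h : u % 8 = 1 ∨ u % 8 = 3 ∨ u % 8 = 5 ∨ u % 8 = 7 := by
      have := Int.odd_iff.1 hu
      omega
    have h8 : (2 : ℤ) ^ 3 = 8 := by norm_num
    simp only [Int.ModEq, h8]
    rcases h with h | h | h | h
    · exact ⟨0, .inl (by simpa using h)⟩
    · exact ⟨1, .inl (by simp [h, hq])⟩
    · exact ⟨1, .inr (by rw [pow_one]; omega)⟩
    · exact ⟨0, .inr (by rw [pow_zero]; omega)⟩
  | succ i hi ih =>
    obtain ⟨l, rfl⟩ : ∃ l, i = l + 3 := ⟨i - 3, by omega⟩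
    obtain ⟨k, hk⟩ := ih
    have hpow := pow_two_pow_modEq hq l
    have hqk : Odd (q ^ k) := Odd.pow (by rw [Int.odd_iff]; omega)
    have aux {v : ℤ} (hv : Odd v) (h : u ≡ v [ZMOD 2 ^ (l + 3)]) :
        u ≡ v [ZMOD 2 ^ (l + 3 + 1)] ∨ u ≡ v * q ^ 2 ^ (l + 1) [ZMOD 2 ^ (l + 3 + 1)] := by
      obtain ⟨z, hz⟩ := Int.modEq_iff_dvd.1 h.symm
      obtain ⟨w, rfl⟩ := hv
      rcases Int.even_or_odd' z with ⟨y, rfl | rfl⟩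
      · exact .inl (Int.modEq_iff_dvd.2 ⟨-y, by rw [pow_succ]; linarith⟩)
      · refine .inr (Int.ModEq.trans (Int.modEq_iff_dvd.2 ⟨w - y, ?_⟩) (hpow.mul_left _).symm)
        rw [eq_add_of_sub_eq hz]
        ring
    rcases hk with hk | hk
    · rcases aux hqk hk with h | h
      · exact ⟨k, .inl h⟩
      · exact ⟨k + 2 ^ (l + 1), .inl (by rwa [pow_add q])⟩
    · rcases aux hqk.neg hk with h | h
      · exact ⟨k, .inr h⟩
      · exact ⟨k + 2 ^ (l + 1), .inr (by rwa [pow_add q, ← neg_mul])⟩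

end Residues

/-! ### Minimal polynomials of roots of unity of two-power order -/

section Minpoly

variable {F : Type*} [Field F] {E : Type*} [Field E] [Algebra F E]

lemma aeval_eq_zero_of_minpoly_eq {x y : E} (h : minpoly F x = minpoly F y) {g : F[X]}
    (hg : aeval x g = 0) : aeval y g = 0 := by
  obtain ⟨c, rfl⟩ := minpoly.dvd F x hg
  simp [h]

lemma minpoly_eq_of_aeval_eq_zero {x y : E} (hx : IsIntegral F x)
    (h : aeval y (minpoly F x) = 0) : minpoly F y = minpoly F x :=
  (minpoly.eq_of_irreducible_of_monic (minpoly.irreducible hx) h (minpoly.monic hx)).symm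

lemma minpoly_pow_card_pow [Fintype F] {x : E} (hx : IsIntegral F x) (k : ℕ) :
    minpoly F (x ^ Fintype.card F ^ k) = minpoly F x := by
  induction k with
  | zero => simp
  | succ k ih =>
    rw [← ih, pow_succ, pow_mul]
    refine minpoly_eq_of_aeval_eq_zero (hx.pow _) ?_
    rw [← expand_aeval, FiniteField.expand_card, map_pow, minpoly.aeval,
      zero_pow Fintype.card_ne_zero]

lemma IsPrimitiveRoot.isIntegral_field {x : E} {n : ℕ} (hx : IsPrimitiveRoot x n) (hn : 0 < n) :
    IsIntegral F x :=
  IsIntegral.of_pow hn (by rw [hx.pow_eq_one]; exact isIntegral_one)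

lemma IsPrimitiveRoot.eq_of_minpoly_eq {x y : E} {n k : ℕ} (hx : IsPrimitiveRoot x n)
    (hy : IsPrimitiveRoot y k) (h : minpoly F x = minpoly F y) : n = k := by
  have key {z w : E} (h : minpoly F z = minpoly F w) {l : ℕ} (hz : z ^ l = 1) : w ^ l = 1 := by
    have := aeval_eq_zero_of_minpoly_eq h (g := X ^ l - 1) (by simp [hz])
    simpa [sub_eq_zero] using this
  exact Nat.dvd_antisymm (hx.dvd_of_pow_eq_one _ (key h.symm hy.pow_eq_one))
    (hy.dvd_of_pow_eq_one _ (key h hx.pow_eq_one))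

/-- Over a field containing `√-2`, a root of unity of order `2 ^ i`, `i ≥ 3`, is not conjugate to
its inverse. -/
lemma minpoly_inv_ne {c : F} (hc : c ^ 2 = -2) (h2 : (2 : E) ≠ 0) {x : E} {i : ℕ}
    (hx : IsPrimitiveRoot x (2 ^ (i + 3))) : minpoly F x⁻¹ ≠ minpoly F x := by
  intro h
  have hx0 : x ≠ 0 := hx.ne_zero (by positivity)
  have hz : IsPrimitiveRoot (x ^ 2 ^ i) 8 := hx.pow (by positivity) (by ring)
  have hz4 : (x ^ 2 ^ i) ^ 4 = -1 :=
    (hz.pow (b := 2) (by norm_num) (by norm_num)).eq_neg_one_of_two_right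
  obtain ⟨d, hd⟩ : ∃ d : F, (x ^ 2 ^ i) ^ 2 - algebraMap F E d * x ^ 2 ^ i - 1 = 0 := by
    have hc' : algebraMap F E c ^ 2 = -2 := by rw [← map_pow, hc, map_neg, map_ofNat]
    have : ((x ^ 2 ^ i) ^ 2 - algebraMap F E c * x ^ 2 ^ i - 1) *
        ((x ^ 2 ^ i) ^ 2 - algebraMap F E (-c) * x ^ 2 ^ i - 1) = 0 := by
      rw [map_neg]
      linear_combination hz4 - (x ^ 2 ^ i) ^ 2 * hc'
    rcases mul_eq_zero.1 this with h | h
    · exact ⟨c, h⟩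
    · exact ⟨-c, h⟩
  have h' := aeval_eq_zero_of_minpoly_eq h.symm
    (g := (X ^ 2 ^ i) ^ 2 - C d * X ^ 2 ^ i - 1) (by simpa using hd)
  simp only [map_sub, map_mul, map_pow, aeval_X, aeval_C, map_one, inv_pow] at h'
  have hz0 : x ^ 2 ^ i ≠ 0 := pow_ne_zero _ hx0
  field_simp at h'
  have h1 : (2 : E) * ((x ^ 2 ^ i) ^ 2 - 1) = 0 := by linear_combination hd - h'
  have hsq : (x ^ 2 ^ i) ^ 2 = 1 := sub_eq_zero.1 ((mul_eq_zero.1 h1).resolve_left h2)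
  have := hz.dvd_of_pow_eq_one _ hsq
  norm_num at this

end Minpoly

/-! ### The factorization of `x ^ (2 ^ r) - 1` over `F_q`, `q ≡ 3 (mod 8)` -/

section Factorization

variable {F : Type*} [Field F] {E : Type*} [Field E] [Algebra F E] {β : E} {r : ℕ}

/-- Representatives of the Galois conjugacy classes of the `2 ^ r`-th roots of unity. -/
def conjRep (β : E) (r : ℕ) : Fin 3 ⊕ Finset.Icc 3 r × Bool → E
  | .inl c => β ^ 2 ^ (r - c)
  | .inr (i, b) => bif b then β ^ 2 ^ (r - i) else (β ^ 2 ^ (r - i))⁻¹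

lemma IsPrimitiveRoot.pow_two_pow_sub (hβ : IsPrimitiveRoot β (2 ^ r)) {i : ℕ} (hi : i ≤ r) :
    IsPrimitiveRoot (β ^ 2 ^ (r - i)) (2 ^ i) :=
  hβ.pow (by positivity) (by rw [← pow_add, Nat.sub_add_cancel hi])

/-- The exponent `i` such that the given representative has order `2 ^ i`. -/
def conjLevel (r : ℕ) : Fin 3 ⊕ Finset.Icc 3 r × Bool → ℕ
  | .inl c => c
  | .inr (i, _) => i

lemma conjLevel_le (hr : 3 ≤ r) (k : Fin 3 ⊕ Finset.Icc 3 r × Bool) : conjLevel r k ≤ r := by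
  rcases k with c | ⟨i, b⟩
  · exact c.2.le.trans hr
  · exact (Finset.mem_Icc.1 i.2).2

lemma isPrimitiveRoot_conjRep (hβ : IsPrimitiveRoot β (2 ^ r)) (hr : 3 ≤ r)
    (k : Fin 3 ⊕ Finset.Icc 3 r × Bool) :
    IsPrimitiveRoot (conjRep β r k) (2 ^ conjLevel r k) := by
  have h := hβ.pow_two_pow_sub (conjLevel_le hr k)
  rcases k with c | ⟨i, _ | _⟩
  · exact h
  · exact h.inv
  · exact h

lemma isIntegral_conjRep (hβ : IsPrimitiveRoot β (2 ^ r)) (hr : 3 ≤ r)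
    (k : Fin 3 ⊕ Finset.Icc 3 r × Bool) : IsIntegral F (conjRep β r k) :=
  (isPrimitiveRoot_conjRep hβ hr k).isIntegral_field (by positivity)

lemma two_ne_zero_of_card [Fintype F] (hq : Fintype.card F % 8 = 3) : (2 : E) ≠ 0 := by
  have h : (2 : F) ≠ 0 := by
    refine Ring.two_ne_zero fun h => ?_
    have := FiniteField.even_card_of_char_two h
    omega
  rw [← map_ofNat (algebraMap F E) 2]
  exact (_root_.map_ne_zero _).2 h

lemma minpoly_conjRep_injective [Fintype F] (hq : Fintype.card F % 8 = 3)
    (hβ : IsPrimitiveRoot β (2 ^ r)) (hr : 3 ≤ r) :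
    Function.Injective fun k => minpoly F (conjRep β r k) := by
  intro k l h
  have hlev : conjLevel r k = conjLevel r l := Nat.pow_right_injective le_rfl
    ((isPrimitiveRoot_conjRep hβ hr k).eq_of_minpoly_eq (isPrimitiveRoot_conjRep hβ hr l) h)
  obtain ⟨c, hc⟩ := (FiniteField.isSquare_neg_two_iff (F := F)).2 (by omega)
  rw [← sq] at hc
  have hne (i : Finset.Icc 3 r) :
      minpoly F (β ^ 2 ^ (r - i))⁻¹ ≠ minpoly F (β ^ 2 ^ (r - i)) := by
    obtain ⟨hi3, hir⟩ := Finset.mem_Icc.1 i.2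
    have := hβ.pow_two_pow_sub hir
    rw [← Nat.sub_add_cancel hi3] at this
    rw [← Nat.sub_add_cancel hi3]
    exact minpoly_inv_ne hc.symm (two_ne_zero_of_card hq) this
  rcases k with c | ⟨i, b⟩ <;> rcases l with c' | ⟨i', b'⟩ <;> simp only [conjLevel] at hlev
  · rw [Fin.ext hlev]
  · have := (Finset.mem_Icc.1 i'.2).1
    omega
  · have := (Finset.mem_Icc.1 i.2).1
    omega
  · obtain rfl : i = i' := Subtype.ext hlev
    cases b <;> cases b' <;> simp only [conjRep, cond_true, cond_false] at h ⊢
    · exact absurd h (hne i)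
    · exact absurd h.symm (hne i)

lemma minpoly_conjRep_isCoprime [Fintype F] (hq : Fintype.card F % 8 = 3)
    (hβ : IsPrimitiveRoot β (2 ^ r)) (hr : 3 ≤ r) :
    Pairwise fun k l => IsCoprime (minpoly F (conjRep β r k)) (minpoly F (conjRep β r l)) := by
  intro k l hkl
  have hk := isIntegral_conjRep (F := F) hβ hr k
  have hl := isIntegral_conjRep (F := F) hβ hr l
  refine ((minpoly.irreducible hk).isCoprime_or_dvd _).resolve_right fun h => hkl ?_
  exact minpoly_conjRep_injective hq hβ hr (eq_of_monic_of_associated (minpoly.monic hk)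
    (minpoly.monic hl) ((minpoly.irreducible hk).associated_of_dvd (minpoly.irreducible hl) h))

lemma exists_minpoly_conjRep_eq [Fintype F] (hq : Fintype.card F % 8 = 3)
    (hβ : IsPrimitiveRoot β (2 ^ r)) (hr : 3 ≤ r) {x : E} (hx : x ^ 2 ^ r = 1) :
    ∃ k, minpoly F (conjRep β r k) = minpoly F x := by
  obtain ⟨n, hn, rfl⟩ := hβ.eq_pow_of_pow_eq_one hx
  rcases eq_or_ne n 0 with rfl | hn0
  · exact ⟨.inl 0, by simp [conjRep, hβ.pow_eq_one]⟩
  obtain ⟨v, u, hu, rfl⟩ := Nat.exists_eq_two_pow_mul_odd hn0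
  have hv : v < r := (Nat.pow_lt_pow_iff_right (by norm_num)).1
    ((Nat.le_mul_of_pos_right _ hu.pos).trans_lt hn)
  obtain ⟨i, hi, rfl⟩ : ∃ i, 0 < i ∧ r = v + i := ⟨r - v, by omega, by omega⟩
  have hprim := hβ.pow_two_pow_sub (i := i) (by omega)
  have hint : IsIntegral F (β ^ 2 ^ (v + i - i)) := hprim.isIntegral_field (by positivity)
  have hne := hprim.ne_zero (by positivity)
  have hconv {a : ℤ} (h : (u : ℤ) ≡ a [ZMOD 2 ^ i]) :
      β ^ (2 ^ v * u) = (β ^ 2 ^ (v + i - i)) ^ a := by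
    obtain ⟨z, hz⟩ := Int.modEq_iff_dvd.1 h
    have h1 := hprim.zpow_eq_one
    push_cast at h1
    rw [eq_add_of_sub_eq' hz, zpow_add₀ hne, zpow_mul, pow_mul, h1, one_zpow, mul_one,
      zpow_natCast, Nat.add_sub_cancel]
  set q := Fintype.card F
  have hq' : (q : ℤ) % 8 = 3 := by omega
  have hu' := hu
  rw [Nat.odd_iff] at hu'
  obtain rfl | rfl | hi3 : i = 1 ∨ i = 2 ∨ 3 ≤ i := by omega
  · refine ⟨.inl 1, ?_⟩
    rw [hconv (a := 1) (by change (u : ℤ) % 2 ^ 1 = 1 % 2 ^ 1; omega), zpow_one]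
    rfl
  · refine ⟨.inl 2, ?_⟩
    obtain ⟨k, hk⟩ : ∃ k : ℕ, (u : ℤ) ≡ (q : ℤ) ^ k [ZMOD 2 ^ 2] := by
      rcases (show u % 4 = 1 ∨ u % 4 = 3 by omega) with h | h
      · exact ⟨0, by change (u : ℤ) % 2 ^ 2 = _ % 2 ^ 2; rw [pow_zero]; omega⟩
      · exact ⟨1, by change (u : ℤ) % 2 ^ 2 = _ % 2 ^ 2; rw [pow_one]; omega⟩
    rw [hconv hk, ← Nat.cast_pow, zpow_natCast, minpoly_pow_card_pow hint]
    rfl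
  · have hmem : i ∈ Finset.Icc 3 (v + i) := Finset.mem_Icc.2 ⟨hi3, by omega⟩
    obtain ⟨k, hk | hk⟩ := exists_modEq_pow_or_neg_pow hq' hi3 (u := u) (by exact_mod_cast hu)
    · refine ⟨.inr (⟨i, hmem⟩, true), ?_⟩
      rw [hconv hk, ← Nat.cast_pow, zpow_natCast, minpoly_pow_card_pow hint]
      rfl
    · refine ⟨.inr (⟨i, hmem⟩, false), ?_⟩
      rw [hconv hk, ← Nat.cast_pow, zpow_neg, zpow_natCast, ← inv_pow,
        minpoly_pow_card_pow hint.inv]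
      rfl

lemma X_pow_two_pow_sub_one_eq_prod [Fintype F] (hq : Fintype.card F % 8 = 3)
    (hβ : IsPrimitiveRoot β (2 ^ r)) (hr : 3 ≤ r) :
    (X ^ 2 ^ r - 1 : F[X]) = ∏ k, minpoly F (conjRep β r k) := by
  have hpow (k) : conjRep β r k ^ 2 ^ r = 1 := by
    rw [(isPrimitiveRoot_conjRep hβ hr k).pow_eq_one_iff_dvd]
    exact pow_dvd_pow _ (conjLevel_le hr k)
  refine eq_of_monic_of_associated ?_ (monic_prod_of_monic _ _ fun k _ =>
    minpoly.monic (isIntegral_conjRep hβ hr k)) (associated_of_dvd_dvd ?_ ?_)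
  · rw [← C_1]
    exact monic_X_pow_sub_C _ (by positivity)
  · rw [← map_dvd_map' (algebraMap F E)]
    have h : (X ^ 2 ^ r - 1 : F[X]).map (algebraMap F E) = X ^ 2 ^ r - 1 := by simp
    rw [h, X_pow_sub_one_eq_prod (by positivity) hβ]
    refine Finset.prod_dvd_of_coprime
      ((pairwise_coprime_X_sub_C Function.injective_id).set_pairwise _) fun x hx => ?_
    rw [mem_nthRootsFinset (by positivity)] at hx
    obtain ⟨k, hk⟩ := exists_minpoly_conjRep_eq hq hβ hr hx
    refine dvd_trans ?_ (Polynomial.map_dvd _ (Finset.dvd_prod_of_mem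
      (fun k => minpoly F (conjRep β r k)) (Finset.mem_univ k)))
    rw [hk, dvd_iff_isRoot, IsRoot.def, eval_map_algebraMap, minpoly.aeval]
  · exact Finset.prod_dvd_of_coprime
      ((minpoly_conjRep_isCoprime hq hβ hr).set_pairwise _) fun k _ => minpoly.dvd _ _
        (by simp [hpow k])

lemma minpoly_conjRep_pairSwap_dvd [Fintype F] (hq : Fintype.card F % 8 = 3)
    (hβ : IsPrimitiveRoot β (2 ^ r)) (hr : 3 ≤ r) {N : ℕ} (hN : 0 < N) (hrN : 2 ^ r ∣ N)
    (k : Fin 3 ⊕ Finset.Icc 3 r × Bool) :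
    minpoly F (conjRep β r (pairSwap _ _ k)) ∣ (minpoly F (conjRep β r k)).comp (X ^ (N - 1)) := by
  refine minpoly.dvd _ _ ?_
  have hprim := isPrimitiveRoot_conjRep hβ hr (pairSwap _ _ k)
  have hinv : conjRep β r (pairSwap _ _ k) ^ (N - 1) = (conjRep β r (pairSwap _ _ k))⁻¹ := by
    refine eq_inv_of_mul_eq_one_left ?_
    rw [← pow_succ, Nat.sub_add_cancel hN, hprim.pow_eq_one_iff_dvd]
    exact (pow_dvd_pow _ (conjLevel_le hr _)).trans hrN
  rw [aeval_comp, map_pow, aeval_X, hinv]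
  rcases k with c | ⟨i, b⟩
  · have hprim' : IsPrimitiveRoot (β ^ 2 ^ (r - c)) (2 ^ (c : ℕ)) := hprim
    have hint : IsIntegral F (β ^ 2 ^ (r - c)) := hprim'.isIntegral_field (by positivity)
    have h : (β ^ 2 ^ (r - c))⁻¹ = (β ^ 2 ^ (r - c)) ^ Fintype.card F ^ 1 := by
      refine (eq_inv_of_mul_eq_one_left ?_).symm
      rw [pow_one, ← pow_succ, hprim'.pow_eq_one_iff_dvd]
      exact (pow_dvd_pow 2 (show (c : ℕ) ≤ 2 by omega)).trans (by omega)
    change aeval (β ^ 2 ^ (r - c))⁻¹ (minpoly F (β ^ 2 ^ (r - c))) = 0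
    rw [← minpoly_pow_card_pow hint 1, h, minpoly.aeval]
  · cases b <;> simp [pairSwap, conjRep]

end Factorization

lemma prod_conjRep_eq {F : Type*} [Field F] {E : Type*} [Field E] [Algebra F E] {β : E} {r : ℕ}
    (hβ : IsPrimitiveRoot β (2 ^ r)) (j : ℤ → ℕ) (t : Fin 3 ⊕ Finset.Icc 3 r × Bool → ℤ)
    (ht0 : t (.inl 0) = 0) (ht1 : t (.inl 1) = 2 ^ (r - 1)) (ht2 : t (.inl 2) = 2 ^ (r - 2))
    (htt : ∀ i, t (.inr (i, true)) = 2 ^ (r - i) * 1)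
    (htf : ∀ i, t (.inr (i, false)) = 2 ^ (r - i) * (-1)) :
    ∏ k, minpoly F (conjRep β r k) ^ j (t k) =
      minpoly F (β ^ (0 : ℤ)) ^ j 0 *
        minpoly F (β ^ ((2 : ℤ) ^ (r - 1))) ^ j (2 ^ (r - 1)) *
        minpoly F (β ^ ((2 : ℤ) ^ (r - 2))) ^ j (2 ^ (r - 2)) *
        ∏ i ∈ Finset.Icc 3 r, ∏ u ∈ ({1, -1} : Finset ℤ),
          minpoly F (β ^ ((2 : ℤ) ^ (r - i) * u)) ^ j (2 ^ (r - i) * u) := by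
  have hz (n : ℕ) : β ^ ((2 : ℤ) ^ n) = β ^ 2 ^ n := by
    rw [← zpow_natCast]; push_cast; rfl
  rw [Fintype.prod_sum_type, Fin.prod_univ_three, Fintype.prod_prod_type, ht0, ht1, ht2,
    ← Finset.prod_coe_sort (Finset.Icc 3 r)]
  congr 1
  · simp [conjRep, hz, hβ.pow_eq_one]
  · refine Finset.prod_congr rfl fun i _ => ?_
    rw [Finset.prod_pair (by norm_num), Fintype.prod_bool, htt, htf]
    simp [conjRep, hz]

/-- for `q = p^m = 2^2·b−1` (`a = 2`, so `O_i = {1,−1}`), the cyclic code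
`C` of length `2^r·p^s` generated by
`m_0^{j_0}·m_{2^{r−1}}^{j_{2^{r−1}}}·m_{2^{r−2}}^{j_{2^{r−2}}}·∏_{i=3}^r ∏_{u∈O_i} m_{2^{r−i}u}^{j_{2^{r−i}u}}`
satisfies `C^⊥ ⊆ C` iff `2j_0 < p^s`, `2j_{2^{r−1}} < p^s`, `2j_{2^{r−2}} < p^s` and
`j_{2^{r−i}u} + j_{2^{r−i}(−u)} ≤ p^s` for all `u ∈ O_i`, `3 ≤ i ≤ r`; moreover the
number of ideals `C` with `C^⊥ ⊆ C` equals `(p^s+2)^{r−2}·((p^s+1)/2)^{r+1}`. -/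
theorem stmt12 (p m a b r s : ℕ) (hp : p.Prime) (hpodd : Odd p) (hm : 0 < m) (hs : 0 < s)
    (hb : Odd b) (ha : a = 2) (hr : 3 ≤ r) (hq : (p : ℤ) ^ m = 2 ^ a * b - 1)
    (F : Type*) [Field F] [Fintype F] (hF : Fintype.card F = p ^ m)
    (E : Type*) [Field E] [Algebra F E] (β : E) (hβ : IsPrimitiveRoot β (2 ^ r))
    (N : ℕ) (hN : N = 2 ^ r * p ^ s) (hf : (X ^ N - 1 : Polynomial F) ≠ 0)
    (j : ℤ → ℕ) (hj : ∀ t ∈ ({0, 2 ^ (r - 1), 2 ^ (r - 2)} : Finset ℤ) ∪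
      (Finset.Icc 3 r).biUnion (fun i =>
        ({1, -1} : Finset ℤ).image fun u => 2 ^ (r - i) * u), j t ≤ p ^ s)
    (C : Ideal (AdjoinRoot (X ^ N - 1 : Polynomial F)))
    (hC : C = Ideal.span {AdjoinRoot.mk (X ^ N - 1 : Polynomial F)
      (minpoly F (β ^ (0 : ℤ)) ^ j 0 *
        minpoly F (β ^ ((2 : ℤ) ^ (r - 1))) ^ j (2 ^ (r - 1)) *
        minpoly F (β ^ ((2 : ℤ) ^ (r - 2))) ^ j (2 ^ (r - 2)) *
        ∏ i ∈ Finset.Icc 3 r, ∏ u ∈ ({1, -1} : Finset ℤ),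
          minpoly F (β ^ ((2 : ℤ) ^ (r - i) * u)) ^ j (2 ^ (r - i) * u))}) :
    (dualCode hf C ⊆ ↑C ↔
      2 * j 0 < p ^ s ∧ 2 * j (2 ^ (r - 1)) < p ^ s ∧ 2 * j (2 ^ (r - 2)) < p ^ s ∧
        ∀ i ∈ Finset.Icc 3 r, ∀ u ∈ ({1, -1} : Finset ℤ),
          j (2 ^ (r - i) * u) + j (2 ^ (r - i) * (-u)) ≤ p ^ s) ∧
    {D : Ideal (AdjoinRoot (X ^ N - 1 : Polynomial F)) | dualCode hf D ⊆ ↑D}.ncard =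
      (p ^ s + 2) ^ (r - 2) * ((p ^ s + 1) / 2) ^ (r + 1) := by
  have hq8 : Fintype.card F % 8 = 3 := by
    obtain ⟨d, rfl⟩ := hb
    subst ha
    rw [hF]
    zify
    rw [hq]
    push_cast
    omega
  have : Fact p.Prime := ⟨hp⟩
  have : CharP F p := charP_of_card_eq_prime_pow hF
  have hN0 : 0 < N := by rw [hN]; exact Nat.mul_pos (by positivity) (pow_pos hp.pos s)
  set P : Fin 3 ⊕ Finset.Icc 3 r × Bool → F[X] := fun k => minpoly F (conjRep β r k)
  have hP (k) : Irreducible (P k) := minpoly.irreducible (isIntegral_conjRep hβ hr k)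
  have hcop : Pairwise fun k l => IsCoprime (P k) (P l) := minpoly_conjRep_isCoprime hq8 hβ hr
  have hfac : (X ^ N - 1 : F[X]) = ∏ k, P k ^ p ^ s := by
    rw [Finset.prod_pow, ← X_pow_two_pow_sub_one_eq_prod hq8 hβ hr, sub_pow_char_pow, one_pow,
      ← pow_mul, ← hN]
  have hrec := minpoly_conjRep_pairSwap_dvd hq8 hβ hr hN0 (hN ▸ dvd_mul_right _ _)
  have hσ := pairSwap_involutive (Fin 3) (Finset.Icc 3 r)
  have hodd : Odd (p ^ s) := hpodd.pow
  constructor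
  · let t : Fin 3 ⊕ Finset.Icc 3 r × Bool → ℤ := Sum.elim ![0, 2 ^ (r - 1), 2 ^ (r - 2)]
      fun x => 2 ^ (r - x.1) * bif x.2 then 1 else -1
    have hCJ : C = codeOfExponents N P fun k => j (t k) := by
      rw [hC, codeOfExponents, prod_conjRep_eq hβ j t] <;> intros <;> rfl
    have hjt (k) : j (t k) ≤ p ^ s := by
      refine hj _ ?_
      simp only [Finset.mem_union, Finset.mem_biUnion, Finset.mem_image]
      rcases k with c | ⟨i, b⟩
      · left
        fin_cases c <;> simp [t]
      · exact .inr ⟨i, i.2, bif b then 1 else -1, by cases b <;> simp, rfl⟩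
    rw [hCJ, dualCode_codeOfExponents_subset_iff hf hN0 hP hcop hfac hσ hrec hjt]
    obtain ⟨d, hd⟩ := hodd
    constructor
    · intro h
      have h0 : j 0 + j 0 ≤ _ := h (.inl 0)
      have h1 : j (2 ^ (r - 1)) + j (2 ^ (r - 1)) ≤ _ := h (.inl 1)
      have h2 : j (2 ^ (r - 2)) + j (2 ^ (r - 2)) ≤ _ := h (.inl 2)
      refine ⟨by omega, by omega, by omega, fun i hi u hu => ?_⟩
      simp only [Finset.mem_insert, Finset.mem_singleton] at hu
      rcases hu with rfl | rfl
      · exact h (.inr (⟨i, hi⟩, true))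
      · exact h (.inr (⟨i, hi⟩, false))
    · rintro ⟨h0, h1, h2, h⟩ (c | ⟨i, b⟩)
      · change j (t (.inl c)) + j (t (.inl c)) ≤ _
        fin_cases c <;> simp [t] <;> omega
      · cases b
        · exact h i i.2 (-1) (by simp)
        · exact h i i.2 1 (by simp)
  · rw [ncard_dualCode_subset hf hN0 hP hcop hfac hσ hrec, ncard_add_pairSwap_le _ _ _ hodd]
    obtain ⟨d, hd⟩ := hodd
    have hcard : Nat.card (Finset.Icc 3 r) = r - 2 := by
      rw [Nat.card_eq_fintype_card, Fintype.card_coe, Nat.card_Icc]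
      omega
    have h1 : (p ^ s + 1) / 2 = d + 1 := by omega
    have h2 : (p ^ s + 1) * (p ^ s + 2) / 2 = (d + 1) * (p ^ s + 2) := by
      rw [show p ^ s + 1 = (d + 1) * 2 by omega, mul_right_comm, Nat.mul_div_cancel _ two_pos]
    rw [hcard, h1, h2, Nat.card_fin, mul_pow, show r + 1 = 3 + (r - 2) by omega, pow_add]
    ring
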